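/- Let χ be a child distribution with all moments finite and let h be a threshold function that is (nonstrictly) increasing. Suppose the system (χ,h) is m-supercordant. Let χ̄ be the m-truncation of χ, defined by χ̄(ℓ) = χ(ℓ) for ℓ ≥ 1 with h(ℓ) ≤ m, χ̄(ℓ) = 0 for ℓ ≥ 1 with h(ℓ) > m, and χ̄(0) = 1 − Σ_{ℓ≥1, h(ℓ)≤m} χ(ℓ). Then the automaton distribution map Ψ̄ of (χ̄,h) has exactly one fixed point in (0,1]: there is a unique x ∈ (0,1] with Ψ̄(x) = x. -/

import Mathlib

/-- `B≥_{n,k}(x) = Σ_{j=k}^{n} C(n,j)·x^j·(1−x)^{n−j}`. -/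
noncomputable def Bge (n k : ℕ) (x : ℝ) : ℝ :=
  ∑ j ∈ Finset.Icc k n, (n.choose j : ℝ) * x ^ j * (1 - x) ^ (n - j)

/-- A child distribution: nonnegative, summable, total mass one. -/
def IsChildDist (χ : ℕ → ℝ) : Prop :=
  (∀ n, 0 ≤ χ n) ∧ Summable χ ∧ (∑' n, χ n) = 1

/-- The automaton distribution map of a recursive tree system `(χ, h)`. -/
noncomputable def Psi (χ : ℕ → ℝ) (h : ℕ → ℕ) (x : ℝ) : ℝ :=
  ∑' n, χ n * Bge n (h n) x

/-- `Ψ` is `m`-concordant: the first `m` derivatives of `Ψ` at `0` (within `[0,1]`)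
match those of the identity, i.e. `Ψ'(0) = 1` and `Ψ^{(k)}(0) = 0` for `2 ≤ k ≤ m`.
(For `m = 0` the condition is vacuous.) -/
def Concordant (m : ℕ) (Ψ : ℝ → ℝ) : Prop :=
  (1 ≤ m → iteratedDerivWithin 1 Ψ (Set.Icc (0 : ℝ) 1) 0 = 1) ∧
  ∀ k, 2 ≤ k → k ≤ m → iteratedDerivWithin k Ψ (Set.Icc (0 : ℝ) 1) 0 = 0

/-- `Ψ` is `m`-supercordant: it is `(m−1)`-concordant and `Ψ^{(m)}(0) > 0` for `m ≥ 2`;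
for `m = 1` the condition is `Ψ'(0) > 1`. -/
def Supercordant (m : ℕ) (Ψ : ℝ → ℝ) : Prop :=
  Concordant (m - 1) Ψ ∧
    (if m = 1 then (1 : ℝ) else 0) < iteratedDerivWithin m Ψ (Set.Icc (0 : ℝ) 1) 0

open Filter Topology Polynomial

/-- The polynomial whose evaluation is the binomial tail `Bge n k`. -/
noncomputable def bernsteinTail (n k : ℕ) : ℝ[X] :=
  ∑ j ∈ Finset.Icc k n, bernsteinPolynomial ℝ n j

lemma eval_bernsteinPolynomial (n k : ℕ) (x : ℝ) :
    (bernsteinPolynomial ℝ n k).eval x = (n.choose k : ℝ) * x ^ k * (1 - x) ^ (n - k) := by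
  simp [bernsteinPolynomial]

lemma eval_bernsteinTail (n k : ℕ) (x : ℝ) : (bernsteinTail n k).eval x = Bge n k x := by
  simp [bernsteinTail, Bge, eval_finsetSum, eval_bernsteinPolynomial]

lemma bernsteinTail_zero_right (n : ℕ) : bernsteinTail n 0 = 1 := by
  rw [← bernsteinPolynomial.sum ℝ n, bernsteinTail]
  congr 1
  ext j
  simp

lemma bernsteinTail_eq_add (n k : ℕ) :
    bernsteinTail n k = bernsteinPolynomial ℝ n k + bernsteinTail n (k + 1) := by
  rcases le_or_gt k n with hk | hk
  · rw [bernsteinTail, ← Finset.insert_Icc_add_one_left_eq_Icc hk, Finset.sum_insert (by simp)]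
    rfl
  · rw [bernsteinPolynomial.eq_zero_of_lt ℝ hk]
    simp [bernsteinTail, Finset.Icc_eq_empty_of_lt hk,
      Finset.Icc_eq_empty_of_lt (hk.trans k.lt_succ_self)]

lemma derivative_bernsteinTail_succ (n k : ℕ) :
    derivative (bernsteinTail (n + 1) (k + 1)) = ((n : ℝ[X]) + 1) * bernsteinPolynomial ℝ n k := by
  have hshift : bernsteinTail (n + 1) (k + 1)
      = ∑ j ∈ Finset.Icc k n, bernsteinPolynomial ℝ (n + 1) (j + 1) := by
    rw [bernsteinTail, ← Finset.map_add_right_Icc k n 1, Finset.sum_map]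
    rfl
  have hshift' : ∑ j ∈ Finset.Icc k n, bernsteinPolynomial ℝ n (j + 1)
      = bernsteinTail n (k + 1) := by
    have : ∑ j ∈ Finset.Icc k n, bernsteinPolynomial ℝ n (j + 1)
        = ∑ j ∈ Finset.Icc (k + 1) (n + 1), bernsteinPolynomial ℝ n j := by
      rw [← Finset.map_add_right_Icc k n 1, Finset.sum_map]
      rfl
    rw [this, bernsteinTail]
    symm
    apply Finset.sum_subset (Finset.Icc_subset_Icc_right n.le_succ)
    intro j hj hj'
    apply bernsteinPolynomial.eq_zero_of_lt
    simp only [Finset.mem_Icc] at hj hj'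
    omega
  rw [hshift, derivative_sum]
  simp_rw [bernsteinPolynomial.derivative_succ_aux]
  rw [← Finset.mul_sum, Finset.sum_sub_distrib, hshift']
  change _ * (bernsteinTail n k - _) = _
  rw [bernsteinTail_eq_add n k]
  ring

lemma derivative_bernsteinTail (n k : ℕ) :
    derivative (bernsteinTail n k)
      = (n : ℝ[X]) * (bernsteinTail (n - 1) (k - 1) - bernsteinTail (n - 1) k) := by
  cases k with
  | zero => simp [bernsteinTail_zero_right]
  | succ k =>
    cases n with
    | zero => simp [bernsteinTail]
    | succ n =>
      rw [derivative_bernsteinTail_succ]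
      simp only [Nat.add_sub_cancel, Nat.cast_add, Nat.cast_one]
      rw [bernsteinTail_eq_add n k]
      ring

lemma eval_bernsteinPolynomial_nonneg (n k : ℕ) {x : ℝ} (hx : x ∈ Set.Icc (0 : ℝ) 1) :
    0 ≤ (bernsteinPolynomial ℝ n k).eval x := by
  rw [eval_bernsteinPolynomial]
  have h0 : 0 ≤ x := hx.1
  have h1 : 0 ≤ 1 - x := sub_nonneg.2 hx.2
  positivity

lemma eval_bernsteinTail_mem (n k : ℕ) {x : ℝ} (hx : x ∈ Set.Icc (0 : ℝ) 1) :
    (bernsteinTail n k).eval x ∈ Set.Icc (0 : ℝ) 1 := by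
  constructor
  · rw [bernsteinTail, eval_finsetSum]
    exact Finset.sum_nonneg fun j _ => eval_bernsteinPolynomial_nonneg n j hx
  · have h1 : (bernsteinTail n 0).eval x = 1 := by simp [bernsteinTail_zero_right]
    rw [← h1, bernsteinTail, bernsteinTail, eval_finsetSum, eval_finsetSum]
    exact Finset.sum_le_sum_of_subset_of_nonneg (Finset.Icc_subset_Icc_left k.zero_le)
      fun j _ _ => eval_bernsteinPolynomial_nonneg n j hx

lemma abs_eval_iterate_derivative_bernsteinTail_le (r n k : ℕ) {x : ℝ}
    (hx : x ∈ Set.Icc (0 : ℝ) 1) :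
    |(derivative^[r] (bernsteinTail n k)).eval x| ≤ (2 * n : ℝ) ^ r := by
  induction r generalizing n k with
  | zero =>
    have := eval_bernsteinTail_mem n k hx
    simpa [abs_of_nonneg this.1] using this.2
  | succ r ih =>
    have hn : ((n - 1 : ℕ) : ℝ) ≤ n := by exact_mod_cast Nat.sub_le n 1
    have hpow : (2 * ((n - 1 : ℕ) : ℝ)) ^ r ≤ (2 * n : ℝ) ^ r := by gcongr
    rw [Function.iterate_succ_apply, derivative_bernsteinTail, iterate_derivative_natCast_mul,
      iterate_derivative_sub, eval_mul, eval_natCast, eval_sub, abs_mul, Nat.abs_cast]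
    have h1 := (ih (n - 1) (k - 1)).trans hpow
    have h2 := (ih (n - 1) k).trans hpow
    calc (n : ℝ) * |_ - _| ≤ n * ((2 * n : ℝ) ^ r + (2 * n : ℝ) ^ r) := by
          gcongr
          exact (abs_sub _ _).trans (add_le_add h1 h2)
      _ = _ := by ring

lemma eval_zero_iterate_derivative_bernsteinTail {r n k : ℕ} (hr : r < k) :
    (derivative^[r] (bernsteinTail n k)).eval 0 = 0 := by
  rw [bernsteinTail, iterate_derivative_sum, eval_finsetSum]
  refine Finset.sum_eq_zero fun j hj => ?_
  exact bernsteinPolynomial.iterate_derivative_at_0_eq_zero_of_lt ℝ n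
    (hr.trans_le (Finset.mem_Icc.1 hj).1)

/-- Term-by-term differentiation of a series on a convex set. -/
lemma hasDerivWithinAt_tsum_of_convex {f f' : ℕ → ℝ → ℝ} {u : ℕ → ℝ} {s : Set ℝ}
    (hs : Convex ℝ s) (hu : Summable u)
    (hf : ∀ n, ∀ x ∈ s, HasDerivWithinAt (f n) (f' n x) s x)
    (hf' : ∀ n, ∀ x ∈ s, |f' n x| ≤ u n)
    (hsum : ∀ x ∈ s, Summable fun n => f n x) {x : ℝ} (hx : x ∈ s) :
    HasDerivWithinAt (fun x => ∑' n, f n x) (∑' n, f' n x) s x := by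
  rw [hasDerivWithinAt_iff_tendsto_slope]
  have hlim : Tendsto (fun z => ∑' n, slope (f n) x z) (𝓝[s \ {x}] x) (𝓝 (∑' n, f' n x)) := by
    refine tendsto_tsum_of_dominated_convergence hu
      (fun n => hasDerivWithinAt_iff_tendsto_slope.1 (hf n x hx)) ?_
    filter_upwards [self_mem_nhdsWithin] with z hz n
    have hzx : 0 < |z - x| := abs_pos.2 (sub_ne_zero.2 hz.2)
    rw [slope_def_field, Real.norm_eq_abs, abs_div, div_le_iff₀ hzx]
    exact hs.norm_image_sub_le_of_norm_hasDerivWithin_le (hf n) (hf' n) hx hz.1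
  refine hlim.congr' ?_
  filter_upwards [self_mem_nhdsWithin] with z hz
  simp_rw [slope_def_field]
  rw [tsum_div_const, (hsum z hz.1).tsum_sub (hsum x hx)]

/-- The series of `r`-th derivatives of the terms of `Psi`. -/
noncomputable def PsiDeriv (χ : ℕ → ℝ) (h : ℕ → ℕ) (r : ℕ) (x : ℝ) : ℝ :=
  ∑' n, χ n * (derivative^[r] (bernsteinTail n (h n))).eval x

section PsiDeriv

variable {χ : ℕ → ℝ} (h : ℕ → ℕ)

lemma PsiDeriv_zero : PsiDeriv χ h 0 = Psi χ h := by
  ext x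
  simp [PsiDeriv, Psi, eval_bernsteinTail]

lemma abs_PsiDeriv_term_le (hχ : ∀ n, 0 ≤ χ n) (r n : ℕ) {x : ℝ} (hx : x ∈ Set.Icc (0 : ℝ) 1) :
    |χ n * (derivative^[r] (bernsteinTail n (h n))).eval x| ≤ χ n * (n : ℝ) ^ r * 2 ^ r := by
  rw [abs_mul, abs_of_nonneg (hχ n), mul_assoc]
  refine mul_le_mul_of_nonneg_left ?_ (hχ n)
  calc _ ≤ (2 * n : ℝ) ^ r := abs_eval_iterate_derivative_bernsteinTail_le r n (h n) hx
    _ = _ := by ring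

lemma summable_PsiDeriv_term (hχ : ∀ n, 0 ≤ χ n)
    (hmom : ∀ j : ℕ, Summable fun n => χ n * (n : ℝ) ^ j) (r : ℕ) {x : ℝ}
    (hx : x ∈ Set.Icc (0 : ℝ) 1) :
    Summable fun n => χ n * (derivative^[r] (bernsteinTail n (h n))).eval x :=
  ((hmom r).mul_right (2 ^ r)).of_norm_bounded fun n => abs_PsiDeriv_term_le h hχ r n hx

lemma hasDerivWithinAt_PsiDeriv (hχ : ∀ n, 0 ≤ χ n)
    (hmom : ∀ j : ℕ, Summable fun n => χ n * (n : ℝ) ^ j) (r : ℕ) {x : ℝ}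
    (hx : x ∈ Set.Icc (0 : ℝ) 1) :
    HasDerivWithinAt (PsiDeriv χ h r) (PsiDeriv χ h (r + 1) x) (Set.Icc 0 1) x := by
  refine hasDerivWithinAt_tsum_of_convex (convex_Icc 0 1) ((hmom (r + 1)).mul_right (2 ^ (r + 1)))
    (fun n y _ => ?_) (fun n y hy => abs_PsiDeriv_term_le h hχ (r + 1) n hy)
    (fun y hy => summable_PsiDeriv_term h hχ hmom r hy) hx
  rw [Function.iterate_succ_apply']
  exact ((Polynomial.hasDerivAt _ y).const_mul _).hasDerivWithinAt

lemma iteratedDerivWithin_Psi (hχ : ∀ n, 0 ≤ χ n)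
    (hmom : ∀ j : ℕ, Summable fun n => χ n * (n : ℝ) ^ j) (r : ℕ) {x : ℝ}
    (hx : x ∈ Set.Icc (0 : ℝ) 1) :
    iteratedDerivWithin r (Psi χ h) (Set.Icc 0 1) x = PsiDeriv χ h r x := by
  induction r generalizing x with
  | zero => rw [iteratedDerivWithin_zero, PsiDeriv_zero]
  | succ r ih =>
    rw [iteratedDerivWithin_succ, derivWithin_congr (fun y hy => ih hy) (ih hx)]
    exact (hasDerivWithinAt_PsiDeriv h hχ hmom r hx).derivWithin
      (uniqueDiffOn_Icc zero_lt_one x hx)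

end PsiDeriv

/-- If `f (k + 1)` is the derivative of `f k` on `[0, 1]` and `f k 0 = 0` for `k < i`, then
`f 0 x / x ^ i` tends to `f i 0 / i!` as `x` decreases to `0`. -/
lemma tendsto_div_pow_of_hasDerivWithinAt (i : ℕ) (f : ℕ → ℝ → ℝ)
    (hf : ∀ k, ∀ x ∈ Set.Icc (0 : ℝ) 1, HasDerivWithinAt (f k) (f (k + 1) x) (Set.Icc 0 1) x)
    (h0 : ∀ k < i, f k 0 = 0) :
    Tendsto (fun x => f 0 x / x ^ i) (𝓝[>] 0) (𝓝 (f i 0 / (i.factorial : ℝ))) := by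
  have hcont : Tendsto (f 0) (𝓝[>] 0) (𝓝 (f 0 0)) :=
    ((hf 0 0 (by simp)).continuousWithinAt.mono_of_mem_nhdsWithin
      (Icc_mem_nhdsGT zero_lt_one)).tendsto
  induction i generalizing f with
  | zero => simpa using hcont
  | succ i ih =>
    have hstep := ih (fun k => f (k + 1)) (fun k => hf (k + 1)) (fun k hk => h0 _ (by omega))
      ((hf 1 0 (by simp)).continuousWithinAt.mono_of_mem_nhdsWithin
        (Icc_mem_nhdsGT zero_lt_one)).tendsto
    refine HasDerivAt.lhopital_zero_nhdsGT (f' := f 1) (g' := fun x => ((i : ℝ) + 1) * x ^ i)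
      ?_ ?_ ?_ ?_ ?_ ?_
    · filter_upwards [Ioo_mem_nhdsGT (zero_lt_one (α := ℝ))] with x hx
      exact (hf 0 x ⟨hx.1.le, hx.2.le⟩).hasDerivAt (Icc_mem_nhds hx.1 hx.2)
    · filter_upwards with x
      simpa using hasDerivAt_pow (i + 1) x
    · filter_upwards [self_mem_nhdsWithin] with x hx
      have : 0 < x := hx
      positivity
    · rw [h0 0 (by omega)] at hcont
      exact hcont
    · have : Tendsto (fun x : ℝ => x ^ (i + 1)) (𝓝 0) (𝓝 (0 ^ (i + 1))) :=
        (continuous_pow (i + 1)).tendsto 0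
      rw [zero_pow (by omega)] at this
      exact this.mono_left nhdsWithin_le_nhds
    · have hlim := hstep.div_const ((i : ℝ) + 1)
      have heq : f (i + 1) 0 / (i.factorial : ℝ) / ((i : ℝ) + 1)
          = f (i + 1) 0 / ((i + 1).factorial : ℝ) := by
        rw [Nat.factorial_succ, div_div]
        push_cast
        ring
      rw [heq] at hlim
      refine hlim.congr fun x => ?_
      rw [div_div, mul_comm]

/-- All absolute moments of the sequence `c` are finite. -/
def HasMoments (c : ℕ → ℝ) : Prop :=
  ∀ r : ℕ, Summable fun n => |c n| * ((n : ℝ) + 1) ^ r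

/-- The negated tail sums of `c`. -/
noncomputable def negTail (c : ℕ → ℝ) (n : ℕ) : ℝ := -∑' k, c (k + (n + 1))

namespace HasMoments

variable {c d : ℕ → ℝ}

lemma summable (hc : HasMoments c) : Summable c := by
  have := hc 0
  simp only [pow_zero, mul_one] at this
  exact this.of_abs

lemma add (hc : HasMoments c) (hd : HasMoments d) : HasMoments fun n => c n + d n := by
  intro r
  refine ((hc r).add (hd r)).of_nonneg_of_le (fun n => by positivity) fun n => ?_
  rw [← add_mul]
  gcongr
  exact abs_add_le _ _

lemma norm_mul_pow_le (c : ℕ → ℝ) {y : ℝ} (hy : y ∈ Set.Icc (0 : ℝ) 1) (n : ℕ) :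
    ‖c n * y ^ n‖ ≤ |c n| := by
  rw [norm_mul, Real.norm_eq_abs, Real.norm_of_nonneg (pow_nonneg hy.1 n)]
  exact mul_le_of_le_one_right (abs_nonneg _) (pow_le_one₀ hy.1 hy.2)

lemma summable_mul_pow (hc : HasMoments c) {y : ℝ} (hy : y ∈ Set.Icc (0 : ℝ) 1) :
    Summable fun n => c n * y ^ n :=
  hc.summable.abs.of_norm_bounded (norm_mul_pow_le c hy)

lemma continuousOn_tsum_mul_pow (hc : HasMoments c) :
    ContinuousOn (fun y : ℝ => ∑' n, c n * y ^ n) (Set.Icc 0 1) :=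
  continuousOn_tsum (fun n => by fun_prop) hc.summable.abs
    fun n _ hy => norm_mul_pow_le c hy n

lemma abs_negTail_mul_pow_le (hc : HasMoments c) (r n : ℕ) :
    |negTail c n| * ((n : ℝ) + 1) ^ r ≤ ∑' k, |c k| * ((k : ℝ) + 1) ^ r := by
  have hshift : Summable fun k => |c (k + (n + 1))| :=
    (summable_nat_add_iff (f := fun k => |c k|) (n + 1)).2 hc.summable.abs
  have habs : |negTail c n| ≤ ∑' k, |c (k + (n + 1))| := by
    rw [negTail, abs_neg]
    simp only [← Real.norm_eq_abs] at hshift ⊢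
    exact norm_tsum_le_tsum_norm hshift
  have hshift' : Summable fun k => |c (k + (n + 1))| * (((k + (n + 1) : ℕ) : ℝ) + 1) ^ r :=
    (summable_nat_add_iff (f := fun k => |c k| * ((k : ℝ) + 1) ^ r) (n + 1)).2 (hc r)
  calc |negTail c n| * ((n : ℝ) + 1) ^ r
      ≤ (∑' k, |c (k + (n + 1))|) * ((n : ℝ) + 1) ^ r := by gcongr
    _ = ∑' k, |c (k + (n + 1))| * ((n : ℝ) + 1) ^ r := tsum_mul_right.symm
    _ ≤ ∑' k, |c (k + (n + 1))| * (((k + (n + 1) : ℕ) : ℝ) + 1) ^ r := by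
        refine (hshift.mul_right _).tsum_le_tsum (fun k => ?_) hshift'
        have : (n : ℝ) ≤ ((k + (n + 1) : ℕ) : ℝ) := by exact_mod_cast (by omega)
        gcongr
    _ ≤ ∑' k, |c k| * ((k : ℝ) + 1) ^ r := by
        rw [← (hc r).sum_add_tsum_nat_add (n + 1)]
        exact le_add_of_nonneg_left (Finset.sum_nonneg fun k _ => by positivity)

lemma hasMoments_negTail (hc : HasMoments c) : HasMoments (negTail c) := by
  intro r
  have hp : Summable fun n : ℕ => 1 / ((n : ℝ) + 1) ^ 2 := by
    have := (summable_nat_add_iff 1).2 (Real.summable_one_div_nat_pow.2 one_lt_two)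
    simpa only [Nat.cast_add, Nat.cast_one] using this
  refine (hp.mul_left (∑' k, |c k| * ((k : ℝ) + 1) ^ (r + 2))).of_nonneg_of_le
    (fun n => by positivity) fun n => ?_
  rw [mul_one_div, le_div_iff₀ (by positivity), mul_assoc, ← pow_add]
  exact hc.abs_negTail_mul_pow_le (r + 2) n

end HasMoments

lemma negTail_succ {c : ℕ → ℝ} (hc : Summable c) (n : ℕ) :
    negTail c (n + 1) = negTail c n + c (n + 1) := by
  have h1 := ((summable_nat_add_iff (n + 1)).2 hc).tsum_eq_zero_add
  simp only [negTail]
  rw [h1]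
  have : ∀ k, k + 1 + (n + 1) = k + (n + 1 + 1) := fun k => by omega
  simp only [this, zero_add]
  ring

lemma one_sub_mul_tsum_negTail {c : ℕ → ℝ} (hc : HasMoments c) {y : ℝ}
    (hy : y ∈ Set.Icc (0 : ℝ) 1) :
    (1 - y) * ∑' n, negTail c n * y ^ n = (∑' n, c n * y ^ n) - ∑' n, c n := by
  have hq := hc.hasMoments_negTail.summable_mul_pow hy
  have hcy := hc.summable_mul_pow hy
  have h0 : negTail c 0 = c 0 - ∑' n, c n := by
    rw [hc.summable.tsum_eq_zero_add]
    simp [negTail]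
  have h1 : ∑' n, negTail c (n + 1) * y ^ (n + 1)
      = y * (∑' n, negTail c n * y ^ n) + ∑' n, c (n + 1) * y ^ (n + 1) := by
    rw [← tsum_mul_left, ← (hq.mul_left y).tsum_add ((summable_nat_add_iff 1).2 hcy)]
    refine tsum_congr fun n => ?_
    rw [negTail_succ hc.summable]
    ring
  have h2 := hq.tsum_eq_zero_add
  have h3 := hcy.tsum_eq_zero_add
  rw [h1] at h2
  simp only [pow_zero, mul_one] at h2 h3
  linarith

/-- The sequence `q` is nonpositive, `p` is nonnegative, and the support of `q` lies weakly
below the support of `p`. -/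
structure SignSplit (q p : ℕ → ℝ) : Prop where
  nonpos : ∀ n, q n ≤ 0
  nonneg : ∀ n, 0 ≤ p n
  le : ∀ n n', q n ≠ 0 → p n' ≠ 0 → n ≤ n'

namespace SignSplit

variable {q p : ℕ → ℝ}

lemma negTail_nonpos (hs : SignSplit q p) (hsum : Summable fun n => q n + p n)
    (h0 : ∑' n, (q n + p n) = 0) (n : ℕ) : negTail (fun n => q n + p n) n ≤ 0 := by
  rw [negTail, neg_nonpos]
  by_cases hp : ∃ n₀ ≤ n, p n₀ ≠ 0
  · obtain ⟨n₀, hn₀, hpn⟩ := hp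
    refine tsum_nonneg fun k => ?_
    have hq : q (k + (n + 1)) = 0 := by
      by_contra hq
      have := hs.le _ _ hq hpn
      omega
    rw [hq, zero_add]
    exact hs.nonneg _
  · push Not at hp
    have hsplit := hsum.sum_add_tsum_nat_add (n + 1)
    have hle : ∑ k ∈ Finset.range (n + 1), (q k + p k) ≤ 0 := by
      refine Finset.sum_nonpos fun k hk => ?_
      rw [hp k (by simpa [Nat.lt_succ_iff] using hk), add_zero]
      exact hs.nonpos k
    linarith

lemma step (hs : SignSplit q p) (hsum : Summable fun n => q n + p n)
    (h0 : ∑' n, (q n + p n) = 0) {p' : ℕ → ℝ} (hp' : ∀ n, 0 ≤ p' n)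
    (hpp' : ∀ n n', p' n' ≠ 0 → p n ≠ 0 → n ≤ n' + 1) :
    SignSplit (negTail fun n => q n + p n) p' where
  nonpos := hs.negTail_nonpos hsum h0
  nonneg := hp'
  le n n' hq hpn := by
    by_contra! hlt
    refine hq (le_antisymm (hs.negTail_nonpos hsum h0 n) ?_)
    rw [negTail, neg_nonneg]
    refine tsum_nonpos fun k => ?_
    have hp : p (k + (n + 1)) = 0 := by
      by_contra hp
      have := hpp' _ _ hpn hp
      omega
    rw [hp, add_zero]
    exact hs.nonpos _

/-- A power series whose coefficients change sign once, from negative to positive, stays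
nonnegative once it is nonnegative. -/
lemma tsum_mul_pow_nonneg (hs : SignSplit q p) (hm : HasMoments fun n => q n + p n)
    (hpos : 0 < ∑' n, (q n + p n)) {y z : ℝ} (hy : 0 < y) (hyz : y ≤ z) (hz : z ≤ 1)
    (hC : 0 ≤ ∑' n, (q n + p n) * y ^ n) : 0 ≤ ∑' n, (q n + p n) * z ^ n := by
  have hex : ∃ n, p n ≠ 0 := by
    by_contra! hp
    refine hpos.not_ge (tsum_nonpos fun n => ?_)
    rw [hp n, add_zero]
    exact hs.nonpos n
  classical
  obtain ⟨d, hdp, hmin⟩ : ∃ d, p d ≠ 0 ∧ ∀ n < d, p n = 0 :=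
    ⟨Nat.find hex, Nat.find_spec hex, fun n hn => by simpa using Nat.find_min hex hn⟩
  have hz0 : 0 < z := hy.trans_le hyz
  have hsy := hm.summable_mul_pow (y := y) ⟨hy.le, hyz.trans hz⟩
  have hsz := hm.summable_mul_pow (y := z) ⟨hz0.le, hz⟩
  have hkey : z ^ d * ∑' n, (q n + p n) * y ^ n ≤ y ^ d * ∑' n, (q n + p n) * z ^ n := by
    rw [← tsum_mul_left, ← tsum_mul_left]
    refine (hsy.mul_left _).tsum_le_tsum (fun n => ?_) (hsz.mul_left _)
    have hp0 := hs.nonneg n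
    have hq0 := hs.nonpos n
    rcases lt_trichotomy n d with hn | hn | hn
    · have hp : p n = 0 := hmin n hn
      obtain ⟨e, rfl⟩ : ∃ e, d = n + e := ⟨d - n, by omega⟩
      have he : y ^ e ≤ z ^ e := by gcongr
      have := mul_le_mul_of_nonpos_left he
        (mul_nonpos_of_nonpos_of_nonneg hq0 (by positivity : 0 ≤ y ^ n * z ^ n))
      rw [hp, pow_add, pow_add]
      linarith
    · rw [hn]
      linarith
    · have hq : q n = 0 := by
        by_contra hq
        exact hn.not_ge (hs.le _ _ hq hdp)
      obtain ⟨e, rfl⟩ : ∃ e, n = d + e := ⟨n - d, by omega⟩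
      have he : y ^ e ≤ z ^ e := by gcongr
      have := mul_le_mul_of_nonneg_left he
        (mul_nonneg hp0 (by positivity : 0 ≤ y ^ d * z ^ d))
      rw [hq, pow_add, pow_add]
      linarith
  exact nonneg_of_mul_nonneg_right (le_trans (by positivity) hkey) (by positivity)

end SignSplit

/-- The power series with coefficients `c`. -/
noncomputable def genFun (c : ℕ → ℝ) (y : ℝ) : ℝ := ∑' n, c n * y ^ n

lemma genFun_one (c : ℕ → ℝ) : genFun c 1 = ∑' n, c n := by simp [genFun]

lemma genFun_add {c d : ℕ → ℝ} (hc : HasMoments c) (hd : HasMoments d) {y : ℝ}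
    (hy : y ∈ Set.Icc (0 : ℝ) 1) :
    genFun (fun n => c n + d n) y = genFun c y + genFun d y := by
  simp only [genFun, add_mul]
  exact (hc.summable_mul_pow hy).tsum_add (hd.summable_mul_pow hy)

/-- The coefficient of `x ^ i * (1 - x) ^ n` contributed to `Ψ'(x)` by threshold `i + 1`. -/
noncomputable def levelCoeff (χ : ℕ → ℝ) (h : ℕ → ℕ) (i n : ℕ) : ℝ :=
  if h (n + (i + 1)) = i + 1 then
    χ (n + (i + 1)) * (((n + i : ℕ) + 1 : ℝ) * ((n + i).choose i : ℝ)) else 0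

/-- The coefficients in powers of `1 - x` of what remains of `-1` and of the levels below `i`
after `x ^ i` has been factored out. -/
noncomputable def remCoeff (p : ℕ → ℕ → ℝ) : ℕ → ℕ → ℝ
  | 0 => fun n => if n = 0 then -1 else 0
  | i + 1 => negTail fun n => remCoeff p i n + p i n

section Level

variable {χ : ℕ → ℝ} {h : ℕ → ℕ}

lemma levelCoeff_nonneg (hχ : ∀ n, 0 ≤ χ n) (i n : ℕ) : 0 ≤ levelCoeff χ h i n := by
  unfold levelCoeff
  have := hχ (n + (i + 1))
  split_ifs <;> positivity

lemma threshold_of_levelCoeff_ne_zero {i n : ℕ} (hn : levelCoeff χ h i n ≠ 0) :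
    h (n + (i + 1)) = i + 1 := by
  by_contra hne
  exact hn (if_neg hne)

lemma hasMoments_levelCoeff (hχ : ∀ n, 0 ≤ χ n)
    (hmom : ∀ j : ℕ, Summable fun n => χ n * (n : ℝ) ^ j) (i : ℕ) :
    HasMoments (levelCoeff χ h i) := by
  intro r
  have hs := (summable_nat_add_iff (f := fun n => χ n * (n : ℝ) ^ (1 + i + r)) (i + 1)).2
    (hmom (1 + i + r))
  refine hs.of_nonneg_of_le (fun n => by positivity) fun n => ?_
  rw [abs_of_nonneg (levelCoeff_nonneg hχ i n)]
  have hχn := hχ (n + (i + 1))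
  unfold levelCoeff
  split_ifs
  · rw [mul_assoc, pow_add, pow_add, pow_one]
    have h1 : ((n + i : ℕ) + 1 : ℝ) = ((n + (i + 1) : ℕ) : ℝ) := by push_cast; ring
    have h2 : ((n + i).choose i : ℝ) ≤ ((n + (i + 1) : ℕ) : ℝ) ^ i := by
      calc ((n + i).choose i : ℝ) ≤ ((n + i : ℕ) : ℝ) ^ i := by
            exact_mod_cast Nat.choose_le_pow (n + i) i
        _ ≤ _ := by
            have : ((n + i : ℕ) : ℝ) ≤ ((n + (i + 1) : ℕ) : ℝ) := by exact_mod_cast (by omega)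
            gcongr
    have h3 : (n : ℝ) + 1 ≤ ((n + (i + 1) : ℕ) : ℝ) := by exact_mod_cast (by omega)
    rw [h1]
    gcongr
  · rw [zero_mul]
    positivity

lemma hasSum_level (hχ : ∀ n, 0 ≤ χ n)
    (hmom : ∀ j : ℕ, Summable fun n => χ n * (n : ℝ) ^ j) (i : ℕ) {x : ℝ}
    (hx : x ∈ Set.Icc (0 : ℝ) 1) :
    HasSum (fun n => if h n = i + 1 then
        χ n * (derivative (bernsteinTail n (h n))).eval x else 0)
      (x ^ i * genFun (levelCoeff χ h i) (1 - x)) := by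
  have hy : 1 - x ∈ Set.Icc (0 : ℝ) 1 := ⟨by linarith [hx.2], by linarith [hx.1]⟩
  have hs := ((hasMoments_levelCoeff (h := h) hχ hmom i).summable_mul_pow hy).hasSum.mul_left
    (x ^ i)
  rw [← hasSum_nat_add_iff' (i + 1), Finset.sum_eq_zero, sub_zero]
  · refine hs.congr_fun ?_
    intro n
    unfold levelCoeff
    split_ifs with hn
    · rw [hn, ← add_assoc, derivative_bernsteinTail_succ, eval_mul, eval_bernsteinPolynomial]
      simp only [eval_add, eval_natCast, eval_one, Nat.add_sub_cancel]
      ring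
    · simp
  · intro n hn
    rw [Finset.mem_range] at hn
    split_ifs with hi
    · simp [hi, bernsteinTail, Finset.Icc_eq_empty_of_lt hn]
    · rfl

lemma PsiDeriv_one_truncation (hχ : ∀ n, 0 ≤ χ n)
    (hmom : ∀ j : ℕ, Summable fun n => χ n * (n : ℝ) ^ j) (hh : ∀ n, 1 ≤ h n) (m : ℕ) {x : ℝ}
    (hx : x ∈ Set.Icc (0 : ℝ) 1) :
    PsiDeriv (fun n => if h n ≤ m then χ n else 0) h 1 x
      = ∑ j ∈ Finset.Ico 0 m, x ^ j * genFun (levelCoeff χ h j) (1 - x) := by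
  refine HasSum.tsum_eq ?_
  refine (hasSum_sum fun j _ => hasSum_level (h := h) hχ hmom j hx).congr_fun fun n => ?_
  have h1 := hh n
  simp only [Function.iterate_one]
  split_ifs with hn
  · rw [Finset.sum_eq_single_of_mem (h n - 1) (Finset.mem_Ico.2 (by omega)), if_pos (by omega)]
    intro j _ hj
    rw [if_neg (by omega)]
  · rw [zero_mul, Finset.sum_eq_zero]
    intro j hj
    rw [Finset.mem_Ico] at hj
    rw [if_neg (by omega)]

end Level

/-- Continuity of the normalised remainder at `0` identifies the limit of `F x / x ^ i`. -/
lemma tendsto_div_pow_of_expansion {F : ℝ → ℝ} {i m : ℕ} (him : i < m) {q : ℕ → ℝ}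
    {p : ℕ → ℕ → ℝ} (hq : HasMoments q) (hp : ∀ j, HasMoments (p j))
    (hF : ∀ x ∈ Set.Icc (0 : ℝ) 1,
      F x = x ^ i * genFun q (1 - x) + ∑ j ∈ Finset.Ico i m, x ^ j * genFun (p j) (1 - x)) :
    Tendsto (fun x => F x / x ^ i) (𝓝[>] 0) (𝓝 (∑' n, (q n + p i n))) := by
  have hcont : ∀ c : ℕ → ℝ, HasMoments c →
      ContinuousOn (fun x => genFun c (1 - x)) (Set.Icc (0 : ℝ) 1) := fun c hc =>
    hc.continuousOn_tsum_mul_pow.comp (f := fun x : ℝ => 1 - x) (by fun_prop)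
      fun x hx => ⟨by linarith [hx.2], by linarith [hx.1]⟩
  have hG : ContinuousOn (fun x => genFun (fun n => q n + p i n) (1 - x)
      + ∑ j ∈ Finset.Ico (i + 1) m, x ^ (j - i) * genFun (p j) (1 - x)) (Set.Icc (0 : ℝ) 1) :=
    (hcont _ (hq.add (hp i))).add <| continuousOn_finsetSum _ fun j _ =>
      (continuousOn_pow (j - i)).mul (hcont _ (hp j))
  have hlim := ((hG 0 (by simp)).mono_of_mem_nhdsWithin (Icc_mem_nhdsGT zero_lt_one)).tendsto
  have hval : ∑ j ∈ Finset.Ico (i + 1) m, (0 : ℝ) ^ (j - i) * genFun (p j) (1 - 0) = 0 := by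
    refine Finset.sum_eq_zero fun j hj => ?_
    rw [Finset.mem_Ico] at hj
    rw [zero_pow (by omega), zero_mul]
  rw [hval, add_zero, sub_zero, genFun_one] at hlim
  refine hlim.congr' ?_
  filter_upwards [Ioo_mem_nhdsGT (zero_lt_one (α := ℝ))] with x hx
  have hxi : x ^ i ≠ 0 := pow_ne_zero _ hx.1.ne'
  have hy : 1 - x ∈ Set.Icc (0 : ℝ) 1 := ⟨by linarith [hx.2], by linarith [hx.1]⟩
  rw [hF x ⟨hx.1.le, hx.2.le⟩, Finset.sum_eq_sum_Ico_succ_bot him, genFun_add hq (hp i) hy,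
    eq_div_iff hxi, add_mul, Finset.sum_mul]
  have : ∀ j ∈ Finset.Ico (i + 1) m, x ^ (j - i) * genFun (p j) (1 - x) * x ^ i
      = x ^ j * genFun (p j) (1 - x) := by
    intro j hj
    rw [Finset.mem_Ico] at hj
    rw [mul_right_comm, ← pow_add, Nat.sub_add_cancel (by omega)]
  rw [Finset.sum_congr rfl this]
  ring

/-- Factoring powers of `x` out of `F = -1 + ∑ j < m, x ^ j * P_j (1 - x)`: as long as the Taylor
coefficients of `F` vanish, the remainder keeps coefficients that change sign only once. -/
lemma remCoeff_spec {p : ℕ → ℕ → ℝ} (hp : ∀ j, HasMoments (p j)) (hp0 : ∀ j n, 0 ≤ p j n)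
    (hpp : ∀ j n n', p (j + 1) n' ≠ 0 → p j n ≠ 0 → n ≤ n' + 1) {m : ℕ} {f : ℕ → ℝ → ℝ}
    (hf : ∀ k, ∀ x ∈ Set.Icc (0 : ℝ) 1, HasDerivWithinAt (f k) (f (k + 1) x) (Set.Icc 0 1) x)
    (hf0 : ∀ x ∈ Set.Icc (0 : ℝ) 1,
      f 0 x = -1 + ∑ j ∈ Finset.Ico 0 m, x ^ j * genFun (p j) (1 - x))
    {i : ℕ} (him : i < m) (hzero : ∀ k < i, f k 0 = 0) :
    (HasMoments (remCoeff p i) ∧ SignSplit (remCoeff p i) (p i) ∧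
      ∀ x ∈ Set.Icc (0 : ℝ) 1, f 0 x = x ^ i * genFun (remCoeff p i) (1 - x)
        + ∑ j ∈ Finset.Ico i m, x ^ j * genFun (p j) (1 - x)) ∧
    ∑' n, (remCoeff p i n + p i n) = f i 0 / (i.factorial : ℝ) := by
  have hval : ∀ {i : ℕ}, i < m → (∀ k < i, f k 0 = 0) → HasMoments (remCoeff p i) →
      (∀ x ∈ Set.Icc (0 : ℝ) 1, f 0 x = x ^ i * genFun (remCoeff p i) (1 - x)
        + ∑ j ∈ Finset.Ico i m, x ^ j * genFun (p j) (1 - x)) →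
      ∑' n, (remCoeff p i n + p i n) = f i 0 / (i.factorial : ℝ) := fun him hz hq hexp =>
    tendsto_nhds_unique (tendsto_div_pow_of_expansion him hq hp hexp)
      (tendsto_div_pow_of_hasDerivWithinAt _ f hf hz)
  suffices hmain : HasMoments (remCoeff p i) ∧ SignSplit (remCoeff p i) (p i) ∧
      ∀ x ∈ Set.Icc (0 : ℝ) 1, f 0 x = x ^ i * genFun (remCoeff p i) (1 - x)
        + ∑ j ∈ Finset.Ico i m, x ^ j * genFun (p j) (1 - x) from
    ⟨hmain, hval him hzero hmain.1 hmain.2.2⟩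
  induction i with
  | zero =>
    refine ⟨fun r => ?_, ⟨fun n => ?_, hp0 0, fun n n' hn _ => ?_⟩, fun x hx => ?_⟩
    · refine summable_of_ne_finset_zero (s := {0}) fun n hn => ?_
      simp [remCoeff, Finset.notMem_singleton.1 hn]
    · simp only [remCoeff]
      split_ifs <;> norm_num
    · have : n = 0 := by
        by_contra h0
        simp [remCoeff, h0] at hn
      omega
    · have : genFun (remCoeff p 0) (1 - x) = -1 := by
        rw [genFun, tsum_eq_single 0 fun n hn => by simp [remCoeff, hn]]
        simp [remCoeff]
      rw [hf0 x hx, this]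
      simp
  | succ i ih =>
    obtain ⟨hq, hs, hexp⟩ := ih (by omega) fun k hk => hzero k (by omega)
    have h0 : ∑' n, (remCoeff p i n + p i n) = 0 := by
      rw [hval (by omega) (fun k hk => hzero k (by omega)) hq hexp, hzero i (by omega), zero_div]
    have hc := hq.add (hp i)
    refine ⟨hc.hasMoments_negTail, hs.step hc.summable h0 (hp0 (i + 1)) (hpp i), fun x hx => ?_⟩
    have hy : 1 - x ∈ Set.Icc (0 : ℝ) 1 := ⟨by linarith [hx.2], by linarith [hx.1]⟩
    have hstep := one_sub_mul_tsum_negTail hc hy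
    rw [h0, sub_zero, sub_sub_cancel] at hstep
    change x * genFun (remCoeff p (i + 1)) (1 - x)
      = genFun (fun n => remCoeff p i n + p i n) (1 - x) at hstep
    rw [genFun_add hq (hp i) hy] at hstep
    rw [hexp x hx, Finset.sum_eq_sum_Ico_succ_bot (by omega), pow_succ, mul_assoc, hstep]
    ring

/-- A function on `[0, 1]` that vanishes at `0`, is positive right of `0`, nonpositive at `1`, and
whose derivative is nonnegative left of any point where it is nonnegative, has exactly one zero
in `(0, 1]`. -/
lemma existsUnique_zero_of_deriv_sign {φ φ' : ℝ → ℝ}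
    (hφ : ∀ x ∈ Set.Icc (0 : ℝ) 1, HasDerivWithinAt φ (φ' x) (Set.Icc 0 1) x)
    (hpos : ∀ᶠ x in 𝓝[>] 0, 0 < φ x) (h1 : φ 1 ≤ 0)
    (hsign : ∀ x z, 0 < x → x ≤ z → z < 1 → 0 ≤ φ' z → 0 ≤ φ' x) :
    ∃! x : ℝ, x ∈ Set.Ioc (0 : ℝ) 1 ∧ φ x = 0 := by
  have hcont : ContinuousOn φ (Set.Icc 0 1) := fun x hx => (hφ x hx).continuousWithinAt
  have hderiv : ∀ x ∈ Set.Ioo (0 : ℝ) 1, HasDerivAt φ (φ' x) x := fun x hx =>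
    (hφ x ⟨hx.1.le, hx.2.le⟩).hasDerivAt (Icc_mem_nhds hx.1 hx.2)
  have hlt : ∀ a b : ℝ, 0 < a → a < b → b ≤ 1 → φ a = 0 → φ b = 0 → False := by
    intro a b ha hab hb hφa hφb
    obtain ⟨ξ, hξ, hξ'⟩ := exists_hasDerivAt_eq_zero hab
      (hcont.mono (Set.Icc_subset_Icc ha.le hb)) (hφa.trans hφb.symm)
      fun x hx => hderiv x ⟨ha.trans hx.1, hx.2.trans_le hb⟩
    have hξ1 : ξ < 1 := hξ.2.trans_le hb
    have hmono : MonotoneOn φ (Set.Icc 0 ξ) := by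
      refine monotoneOn_of_hasDerivWithinAt_nonneg (f' := φ') (convex_Icc 0 ξ)
        (hcont.mono (Set.Icc_subset_Icc_right hξ1.le)) ?_ ?_
      · intro x hx
        rw [interior_Icc] at hx
        exact (hderiv x ⟨hx.1, hx.2.trans hξ1⟩).hasDerivWithinAt
      · intro x hx
        rw [interior_Icc] at hx
        exact hsign x ξ hx.1 hx.2.le hξ1 hξ'.ge
    obtain ⟨x, hx, hxa⟩ := (hpos.and (Ioo_mem_nhdsGT ha)).exists
    have := hmono ⟨hxa.1.le, (hxa.2.trans hξ.1).le⟩ ⟨ha.le, hξ.1.le⟩ hxa.2.le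
    linarith
  obtain ⟨x₀, hx₀, hx₀1⟩ := (hpos.and (Ioo_mem_nhdsGT (zero_lt_one (α := ℝ)))).exists
  obtain ⟨x, hx, hφx⟩ := intermediate_value_Icc' hx₀1.2.le
    (hcont.mono (Set.Icc_subset_Icc_left hx₀1.1.le)) ⟨h1, hx₀.le⟩
  have hx0 : 0 < x := hx₀1.1.trans_le hx.1
  refine ⟨x, ⟨⟨hx0, hx.2⟩, hφx⟩, fun z hz => ?_⟩
  rcases lt_trichotomy z x with hzx | hzx | hzx
  · exact (hlt z x hz.1.1 hzx hx.2 hz.2 hφx).elim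
  · exact hzx
  · exact (hlt x z hx0 hzx hz.1.2 hφx hz.2).elim

theorem stmt17 (m : ℕ) (hm : 1 ≤ m) (χ : ℕ → ℝ) (h : ℕ → ℕ)
    (hχ : IsChildDist χ)
    (hmom : ∀ j : ℕ, Summable fun n => χ n * (n : ℝ) ^ j)
    (hh : ∀ n, 1 ≤ h n) (hmono : Monotone h)
    (hsup : Supercordant m (Psi χ h))
    (χbar : ℕ → ℝ)
    (hbar1 : ∀ n, 1 ≤ n → h n ≤ m → χbar n = χ n)
    (hbar2 : ∀ n, 1 ≤ n → m < h n → χbar n = 0)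
    (hbar0 : χbar 0 = 1 - ∑' n : ℕ, (if 1 ≤ n ∧ h n ≤ m then χ n else 0)) :
    ∃! x : ℝ, x ∈ Set.Ioc (0 : ℝ) 1 ∧ Psi χbar h x = x := by
  obtain ⟨hχ0, hχs, hχ1⟩ := hχ
  set ψ : ℕ → ℝ := fun n => if h n ≤ m then χ n else 0 with hψ
  have hψ0 : ∀ n, 0 ≤ ψ n := fun n => by
    simp only [hψ]
    split_ifs
    exacts [hχ0 n, le_rfl]
  have hψle : ∀ n, ψ n ≤ χ n := fun n => by
    simp only [hψ]
    split_ifs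
    exacts [le_rfl, hχ0 n]
  have hψmom : ∀ j : ℕ, Summable fun n => ψ n * (n : ℝ) ^ j := fun j =>
    (hmom j).of_nonneg_of_le (fun n => mul_nonneg (hψ0 n) (by positivity))
      fun n => mul_le_mul_of_nonneg_right (hψle n) (by positivity)
  have hbar : Psi χbar h = PsiDeriv ψ h 0 := by
    rw [PsiDeriv_zero]
    ext x
    refine tsum_congr fun n => ?_
    rcases Nat.eq_zero_or_pos n with rfl | hn
    · simp [Bge, Finset.Icc_eq_empty_of_lt (Nat.lt_of_lt_of_le Nat.zero_lt_one (hh 0))]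
    · simp only [hψ]
      split_ifs with hnm
      · rw [hbar1 n hn hnm]
      · rw [hbar2 n hn (not_le.1 hnm)]
  -- The truncation and the original system have the same derivatives at `0` up to order `m`.
  have hderiv0 : ∀ k ≤ m, iteratedDerivWithin k (Psi χ h) (Set.Icc 0 1) 0 = PsiDeriv ψ h k 0 := by
    intro k hk
    rw [iteratedDerivWithin_Psi h hχ0 hmom k (by simp)]
    refine tsum_congr fun n => ?_
    simp only [hψ]
    split_ifs with hn
    · rfl
    · rw [eval_zero_iterate_derivative_bernsteinTail (by omega), mul_zero, mul_zero]
  set f : ℕ → ℝ → ℝ := fun k x => PsiDeriv ψ h k x - (derivative^[k] (X : ℝ[X])).eval x with hfdef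
  have hf : ∀ k, ∀ x ∈ Set.Icc (0 : ℝ) 1,
      HasDerivWithinAt (f k) (f (k + 1) x) (Set.Icc 0 1) x := by
    intro k x hx
    refine (hasDerivWithinAt_PsiDeriv h hψ0 hψmom k hx).sub ?_
    rw [Function.iterate_succ_apply']
    exact (Polynomial.hasDerivAt _ x).hasDerivWithinAt
  have hX : ∀ k, 2 ≤ k → derivative^[k] (X : ℝ[X]) = 0 := fun k hk =>
    iterate_derivative_eq_zero (by rw [natDegree_X]; omega)
  have hfzero : ∀ k < m, f k 0 = 0 := by
    intro k hk
    rcases Nat.lt_or_ge k 2 with hk2 | hk2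
    · interval_cases k
      · simp only [hfdef, PsiDeriv]
        rw [tsum_congr (fun n => by
          rw [eval_zero_iterate_derivative_bernsteinTail (hh n), mul_zero]), tsum_zero]
        simp
      · have := hsup.1.1 (by omega)
        rw [hderiv0 1 hm] at this
        simp [hfdef, this]
    · have := hsup.1.2 k hk2 (by omega)
      rw [hderiv0 k hk.le] at this
      simp [hfdef, this, hX k hk2]
  have hfm : 0 < f m 0 := by
    have hlt := hsup.2
    rw [hderiv0 m le_rfl] at hlt
    split_ifs at hlt with hm1
    · simp only [hfdef]
      subst hm1
      simpa using hlt
    · simpa [hfdef, hX m (by omega)] using hlt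
  set p := levelCoeff χ h with hpdef
  have hp : ∀ j, HasMoments (p j) := hasMoments_levelCoeff hχ0 hmom
  have hpp : ∀ j n n', p (j + 1) n' ≠ 0 → p j n ≠ 0 → n ≤ n' + 1 := by
    intro j n n' h1 h2
    have e1 := threshold_of_levelCoeff_ne_zero h1
    have e2 := threshold_of_levelCoeff_ne_zero h2
    by_contra! hlt
    have := hmono (show n' + (j + 1 + 1) ≤ n + (j + 1) by omega)
    omega
  obtain ⟨i, rfl⟩ : ∃ i, m = i + 1 := ⟨m - 1, by omega⟩
  obtain ⟨⟨hq, hs, hexp⟩, hval⟩ := remCoeff_spec hp (levelCoeff_nonneg hχ0) hpp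
    (f := fun k => f (k + 1)) (fun k => hf (k + 1)) (m := i + 1)
    (fun x hx => by
      simp only [hfdef, zero_add]
      rw [PsiDeriv_one_truncation hχ0 hmom hh (i + 1) hx]
      simp [neg_add_eq_sub, hpdef])
    i.lt_succ_self (fun k hk => hfzero (k + 1) (by omega))
  have hsumpos : 0 < ∑' n, (remCoeff p i n + p i n) := by
    rw [hval]
    positivity
  have hφ' : ∀ x ∈ Set.Icc (0 : ℝ) 1,
      f 1 x = x ^ i * genFun (fun n => remCoeff p i n + p i n) (1 - x) := by
    intro x hx
    have hy : 1 - x ∈ Set.Icc (0 : ℝ) 1 := ⟨by linarith [hx.2], by linarith [hx.1]⟩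
    have := hexp x hx
    rw [Nat.Ico_succ_singleton, Finset.sum_singleton] at this
    rw [genFun_add hq (hp i) hy, mul_add]
    exact this
  have hposnear : ∀ᶠ x in 𝓝[>] (0 : ℝ), 0 < f 0 x := by
    have hlim := tendsto_div_pow_of_hasDerivWithinAt (i + 1) f hf hfzero
    filter_upwards [hlim.eventually_const_lt (by positivity), self_mem_nhdsWithin] with x hx hx0
    have hx0' : 0 < x := hx0
    exact (div_pos_iff_of_pos_right (by positivity)).1 hx
  have hf1 : f 0 1 ≤ 0 := by
    have hmem : (1 : ℝ) ∈ Set.Icc (0 : ℝ) 1 := by simp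
    have hle : PsiDeriv ψ h 0 1 ≤ ∑' n, χ n := by
      refine (summable_PsiDeriv_term h hψ0 hψmom 0 hmem).tsum_le_tsum (fun n => ?_) hχs
      have := eval_bernsteinTail_mem n (h n) hmem
      exact (mul_le_of_le_one_right (hψ0 n) this.2).trans (hψle n)
    simp only [hfdef, Function.iterate_zero, id_eq, eval_X]
    linarith
  have hmain := existsUnique_zero_of_deriv_sign (hf 0) hposnear hf1 fun x z hx hxz hz hnn => by
    have hz0 : 0 < z := hx.trans_le hxz
    rw [zero_add, hφ' x ⟨hx.le, hxz.trans hz.le⟩]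
    rw [zero_add, hφ' z ⟨hz0.le, hz.le⟩] at hnn
    refine mul_nonneg (by positivity) ?_
    exact hs.tsum_mul_pow_nonneg (hq.add (hp i)) hsumpos (y := 1 - z) (by linarith)
      (by linarith) (by linarith) (nonneg_of_mul_nonneg_right hnn (by positivity))
  simpa only [hfdef, hbar, Function.iterate_zero, id_eq, eval_X, sub_eq_zero] using hmain
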